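/- arXiv:2009.13006 — 4 statements merged into one kernel-verified Lean document; each statement's English description precedes it below -/
import Mathlib

section
/- Let H_1,…,H_m be connected simple graphs on Fin n and let u be a vertex of Fin n. Define I_0 = {u} and I_i = I_{i−1} ∪ {w : w has a neighbor in I_{i−1} in the graph H_i} for 1 ≤ i ≤ m. Then for every 0 ≤ i ≤ m, |I_i| ≥ min(i + 1, n). In particular, flooding along any sequence of connected graphs is complete after n − 1 rounds. -/
open scoped Classical

noncomputable section

namespace SmoothedFlooding

variable {n : ℕ}

/-- One flooding step: the informed set `I` together with all vertices having a
neighbor in `I` in the graph `H`. -/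
def floodStep (H : SimpleGraph (Fin n)) (I : Set (Fin n)) : Set (Fin n) :=
  I ∪ {w | ∃ v ∈ I, H.Adj v w}

/-- The informed set after flooding from `u` along a sequence of graphs. -/
def flood (u : Fin n) (Hs : List (SimpleGraph (Fin n))) : Set (Fin n) :=
  Hs.foldl (fun I H => floodStep H I) {u}

/-- the spooling graph at time `i` (1 ≤ i ≤ n-1); vertex `a : Fin n` stands for
the label `a + 1 ∈ {1, …, n}`:  edges `(j,i)` for `1 ≤ j ≤ i-1`, edges `(i+1,j)`
for `i+2 ≤ j ≤ n`, and the edge `(i,i+1)`. -/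
def spool (n i : ℕ) : SimpleGraph (Fin n) :=
  SimpleGraph.fromRel (fun a b =>
    (((a : ℕ) + 1 < i) ∧ ((b : ℕ) + 1 = i)) ∨
    (((a : ℕ) + 1 = i + 1) ∧ ((b : ℕ) + 1 ≥ i + 2)) ∨
    (((a : ℕ) + 1 = i) ∧ ((b : ℕ) + 1 = i + 1)))

/-- the `i`-th graph (1-indexed) of the dynamic cassette graph with parameter `t`,
on vertices `{0, …, n-1}`. -/
def cassette (n t i : ℕ) : SimpleGraph (Fin n) :=
  SimpleGraph.fromRel (fun a b =>
    ((b : ℕ) = (a : ℕ) + 1) ∨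
    ((a : ℕ) = 0 ∧ ∃ j, 1 ≤ j ∧ j ≤ (i - 1) / t ∧ (b : ℕ) = j * t) ∨
    ((b : ℕ) = n - 1 ∧ ∃ j, (i - 1) / t + 2 ≤ j ∧ j ≤ (n - 2) / t ∧ (a : ℕ) = j * t))

/-- One flooding step along a connected graph informs a new vertex, unless all are informed. -/
theorem ncard_lt_ncard_floodStep {H : SimpleGraph (Fin n)} (hH : H.Connected)
    {I : Set (Fin n)} (hI : I.Nonempty) (hI' : I ≠ Set.univ) :
    I.ncard < (floodStep H I).ncard := by
  obtain ⟨u, hu⟩ := hI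
  obtain ⟨v, hv⟩ := (Set.ne_univ_iff_exists_notMem I).1 hI'
  obtain ⟨p⟩ := hH.preconnected u v
  obtain ⟨d, -, hd, hd'⟩ := p.exists_boundary_dart I hu hv
  exact Set.ncard_lt_ncard (Set.ssubset_iff_of_subset Set.subset_union_left |>.2
    ⟨d.snd, Or.inr ⟨d.fst, hd, d.adj⟩, hd'⟩) (Set.toFinite _)

theorem min_succ_le_ncard_floodStep {H : SimpleGraph (Fin n)} (hH : H.Connected)
    {I : Set (Fin n)} (hI : I.Nonempty) : min (I.ncard + 1) n ≤ (floodStep H I).ncard := by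
  by_cases h : I = Set.univ
  · simp [h, floodStep]
  · exact (min_le_left _ _).trans (ncard_lt_ncard_floodStep hH hI h)

theorem flood_append_singleton (u : Fin n) (Hs : List (SimpleGraph (Fin n)))
    (H : SimpleGraph (Fin n)) : flood u (Hs ++ [H]) = floodStep H (flood u Hs) := by
  simp [flood]

theorem mem_flood_self (u : Fin n) (Hs : List (SimpleGraph (Fin n))) : u ∈ flood u Hs := by
  induction Hs using List.reverseRecOn with
  | nil => simp [flood]
  | append_singleton Hs H ih =>
    rw [flood_append_singleton]
    exact Or.inl ih

theorem min_length_succ_le_ncard_flood (u : Fin n) (Hs : List (SimpleGraph (Fin n)))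
    (hconn : ∀ H ∈ Hs, H.Connected) : min (Hs.length + 1) n ≤ (flood u Hs).ncard := by
  induction Hs using List.reverseRecOn with
  | nil => simp [flood]
  | append_singleton Hs H ih =>
    have h₁ := ih fun K hK => hconn K (List.mem_append_left _ hK)
    have h₂ := min_succ_le_ncard_floodStep (hconn H (by simp)) ⟨u, mem_flood_self u Hs⟩
    rw [flood_append_singleton, List.length_append, List.length_singleton]
    omega

/-- Flooding along connected graphs informs at least `min(i+1, n)` vertices after `i`
rounds; in particular it is complete after `n - 1` rounds. -/
theorem flooding_connected_progress (n : ℕ) (Hs : List (SimpleGraph (Fin n)))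
    (hconn : ∀ H ∈ Hs, H.Connected) (u : Fin n) :
    (∀ i ≤ Hs.length, min (i + 1) n ≤ (flood u (Hs.take i)).ncard) ∧
    (n - 1 ≤ Hs.length → flood u (Hs.take (n - 1)) = Set.univ) := by
  have key : ∀ i ≤ Hs.length, min (i + 1) n ≤ (flood u (Hs.take i)).ncard := fun i hi => by
    have h := min_length_succ_le_ncard_flood u (Hs.take i)
      fun H hH => hconn H (List.mem_of_mem_take hH)
    rwa [List.length_take_of_le hi] at h
  refine ⟨key, fun hn => (Set.eq_univ_iff_ncard _).2 ?_⟩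
  have h₁ := key (n - 1) hn
  have h₂ := Set.ncard_le_card (flood u (Hs.take (n - 1)))
  rw [Nat.card_fin] at h₂ ⊢
  omega

end SmoothedFlooding
end
end

section
/- Let n ≥ 3 and consider the spooling dynamic graph G_1,…,G_{n−1} on vertices {1,…,n}. Define the flooding sets from vertex 1: I_0 = {1} and I_i = I_{i−1} ∪ {w : w has a neighbor in I_{i−1} in the graph G_i}. Then for every 0 ≤ i ≤ n−1, I_i = {1,…,i+1}. In particular, flooding along the (non-smoothed) spooling dynamic graph is complete after exactly n − 1 rounds and not before. -/
open scoped Classical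

noncomputable section

namespace SmoothedFlooding

variable {n : ℕ}

theorem floodStep_spool (i : ℕ) :
    floodStep (spool n (i + 1)) {w : Fin n | (w : ℕ) ≤ i} = {w : Fin n | (w : ℕ) ≤ i + 1} := by
  ext w
  simp only [floodStep, spool, SimpleGraph.fromRel_adj, Set.mem_union, Set.mem_ofPred_eq]
  constructor
  · rintro (h | ⟨v, hv, -, h⟩) <;> omega
  · intro h
    by_cases hw : (w : ℕ) ≤ i
    · exact Or.inl hw
    · refine Or.inr ⟨⟨i, by omega⟩, le_rfl, fun h' => ?_, Or.inl (Or.inr (Or.inr ?_))⟩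
      · exact hw (by simp [← h'])
      · exact ⟨rfl, by omega⟩

theorem flood_spool (hn : 0 < n) (i : ℕ) (hi : i < n) :
    flood (⟨0, hn⟩ : Fin n) ((List.range i).map (fun j => spool n (j + 1))) =
      {w : Fin n | (w : ℕ) ≤ i} := by
  induction i with
  | zero =>
    ext w
    simp [flood, Fin.ext_iff]
  | succ i ih =>
    rw [← floodStep_spool i, ← ih (by omega)]
    simp [flood, List.range_succ]

/-- Flooding from vertex `1` (index `0`) along the non-smoothed spooling dynamic graph:
after `i` rounds exactly the labels `{1, …, i+1}` (indices `{0, …, i}`) are informed;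
flooding is complete after exactly `n - 1` rounds and not before. -/
theorem spool_flooding (n : ℕ) (hn : 3 ≤ n) :
    (∀ i ≤ n - 1,
        flood (⟨0, by omega⟩ : Fin n) ((List.range i).map (fun j => spool n (j + 1))) =
          {w : Fin n | (w : ℕ) ≤ i}) ∧
    flood (⟨0, by omega⟩ : Fin n) ((List.range (n - 1)).map (fun j => spool n (j + 1))) =
      Set.univ ∧
    (∀ i < n - 1,
        flood (⟨0, by omega⟩ : Fin n) ((List.range i).map (fun j => spool n (j + 1))) ≠
          Set.univ) := by
  refine ⟨fun i hi => flood_spool (by omega) i (by omega), ?_, fun i hi h => ?_⟩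
  · rw [flood_spool (by omega) (n - 1) (by omega)]
    ext w
    simp only [Set.mem_ofPred_eq, Set.mem_univ, iff_true]
    omega
  · rw [flood_spool (by omega) i (by omega)] at h
    have hlast : (⟨n - 1, by omega⟩ : Fin n) ∈ {w : Fin n | (w : ℕ) ≤ i} := h ▸ Set.mem_univ _
    simp only [Set.mem_ofPred_eq] at hlast
    omega

end SmoothedFlooding
end
end

section
/- Let t ≥ 1 and n ≥ 2t + 2 be integers and consider the (non-smoothed) dynamic cassette graph G_1,…,G_n on {0,…,n−1} with parameter t. Define the flooding sets from vertex 0: I_0 = {0} and I_i = I_{i−1} ∪ {w : w has a neighbor in I_{i−1} in the graph G_i}. Then for every 0 ≤ i ≤ n−1, I_i = {0,1,…,min(i, n−1)}. In particular, flooding along the non-smoothed dynamic cassette graph is complete after exactly n − 1 rounds and not before. -/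
open scoped Classical

noncomputable section

namespace SmoothedFlooding

variable {n : ℕ}

/-- While vertex `n - 1` is uninformed, round `i + 1` of the cassette informs exactly
vertex `i + 1`. -/
theorem floodStep_cassette {n t i : ℕ} (ht : 1 ≤ t) (hi : i + 1 ≤ n - 1) :
    floodStep (cassette n t (i + 1)) {w : Fin n | (w : ℕ) ≤ i} =
      {w : Fin n | (w : ℕ) ≤ i + 1} := by
  have mul_le : ∀ j ≤ i / t, j * t ≤ i := fun j hj =>
    (Nat.le_div_iff_mul_le ht).1 hj
  have lt_mul : ∀ j, i / t + 2 ≤ j → i < j * t := fun j hj =>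
    (Nat.div_lt_iff_lt_mul ht).1 (by omega)
  ext w
  simp only [floodStep, cassette, SimpleGraph.fromRel_adj, Set.mem_union, Set.mem_ofPred_eq,
    Nat.add_sub_cancel]
  constructor
  · rintro (hw | ⟨v, hv, -, h | h⟩)
    · omega
    · rcases h with h | ⟨-, j, -, hj, hw⟩ | ⟨-, j, hj, -, hvj⟩
      · omega
      · have := mul_le j hj
        omega
      · have := lt_mul j hj
        omega
    · rcases h with h | ⟨h, -⟩ | ⟨h, -⟩ <;> omega
  · intro hw
    rcases Nat.le_or_eq_of_le_succ hw with hw | hw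
    · exact Or.inl hw
    · refine Or.inr ⟨⟨i, by omega⟩, le_rfl, ?_, Or.inl (Or.inl hw)⟩
      simp only [ne_eq, Fin.ext_iff]
      omega

theorem flood_cassette {n t i : ℕ} (ht : 1 ≤ t) (hn : 0 < n) (hi : i ≤ n - 1) :
    flood (⟨0, hn⟩ : Fin n) ((List.range i).map (fun j => cassette n t (j + 1))) =
      {w : Fin n | (w : ℕ) ≤ i} := by
  induction i with
  | zero =>
    ext w
    simp [flood, Fin.ext_iff]
  | succ i ih =>
    rw [← floodStep_cassette ht hi, ← ih (by omega)]
    simp [flood, List.range_succ]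

/-- Flooding from vertex `0` along the non-smoothed dynamic cassette graph: after `i`
rounds exactly `{0, …, min(i, n-1)}` is informed; flooding is complete after exactly
`n - 1` rounds and not before. -/
theorem cassette_flooding (n t : ℕ) (ht : 1 ≤ t) (hn : 2 * t + 2 ≤ n) :
    (∀ i ≤ n - 1,
        flood (⟨0, by omega⟩ : Fin n) ((List.range i).map (fun j => cassette n t (j + 1))) =
          {w : Fin n | (w : ℕ) ≤ min i (n - 1)}) ∧
    flood (⟨0, by omega⟩ : Fin n)
        ((List.range (n - 1)).map (fun j => cassette n t (j + 1))) = Set.univ ∧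
    (∀ i < n - 1,
        flood (⟨0, by omega⟩ : Fin n)
            ((List.range i).map (fun j => cassette n t (j + 1))) ≠ Set.univ) := by
  refine ⟨fun i hi => ?_, ?_, fun i hi h => ?_⟩
  · rw [flood_cassette ht _ hi, min_eq_left hi]
  · rw [flood_cassette ht _ le_rfl]
    ext w
    simp only [Set.mem_ofPred_eq, Set.mem_univ, iff_true]
    omega
  · rw [flood_cassette ht _ hi.le] at h
    have hlast : (⟨n - 1, by omega⟩ : Fin n) ∈ {w : Fin n | (w : ℕ) ≤ i} := h ▸ Set.mem_univ _
    exact absurd hlast (Nat.not_le.2 hi)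

end SmoothedFlooding
end
end

section
/- Let t ≥ 1 and n ≥ 2t + 2 be integers and consider the dynamic cassette graph G_1,…,G_n on {0,…,n−1} with parameter t. Then for every 1 ≤ i ≤ n, the graph G_i is connected and has diameter at most 5t + 4. -/
open scoped Classical

noncomputable section

namespace SmoothedFlooding

variable {n : ℕ}

theorem edist_le_of_edist_le_of_edist_le {V : Type*} {G : SimpleGraph V} {a b c : V} {k l m : ℕ}
    (hab : G.edist a b ≤ k) (hbc : G.edist b c ≤ l) (h : k + l ≤ m) : G.edist a c ≤ m :=
  calc G.edist a c ≤ G.edist a b + G.edist b c := SimpleGraph.edist_triangle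
    _ ≤ (k : ℕ∞) + l := add_le_add hab hbc
    _ ≤ m := by exact_mod_cast h

/-- A graph in which every vertex is within distance `r` of a vertex `c` is connected and has
diameter at most `2 * r`. -/
theorem connected_and_diam_le_of_edist_le {V : Type*} {G : SimpleGraph V} (c : V) (r : ℕ)
    (h : ∀ v, G.edist v c ≤ r) : G.Connected ∧ G.diam ≤ 2 * r := by
  have huv (u v : V) : G.edist u v ≤ (2 * r : ℕ) :=
    edist_le_of_edist_le_of_edist_le (h u) (SimpleGraph.edist_comm (G := G) ▸ h v) (by omega)
  have : Nonempty V := ⟨c⟩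
  refine ⟨⟨fun u v => SimpleGraph.reachable_of_edist_ne_top
    (ne_top_of_le_ne_top (ENat.natCast_ne_top _) (huv u v))⟩, ?_⟩
  exact ENat.toNat_le_of_le_natCast (SimpleGraph.ediam_le_of_edist_le huv)

theorem cassette_edist_le_sub (t i a b : ℕ) (ha : a < n) (hb : b < n) (hab : a ≤ b) :
    (cassette n t i).edist ⟨a, ha⟩ ⟨b, hb⟩ ≤ (b - a : ℕ) := by
  induction b, hab using Nat.le_induction with
  | base => simp
  | succ b hab ih =>
    have hadj : (cassette n t i).Adj ⟨b, by omega⟩ ⟨b + 1, hb⟩ := by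
      simp [cassette]
    refine edist_le_of_edist_le_of_edist_le (ih (by omega)) (l := 1) ?_ (by omega)
    exact (SimpleGraph.edist_eq_one_iff_adj.mpr hadj).le

theorem cassette_edist_zero_le_one (t i j : ℕ) (hj : j ≤ (i - 1) / t) (h : j * t < n) :
    (cassette n t i).edist ⟨j * t, h⟩ ⟨0, by omega⟩ ≤ (1 : ℕ) := by
  by_cases h0 : j * t = 0
  · simp [h0]
  · refine (SimpleGraph.edist_eq_one_iff_adj.mpr ?_).le
    have hj1 : 1 ≤ j := Nat.pos_of_ne_zero fun hj0 => h0 (by simp [hj0])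
    exact ⟨fun e => h0 (congrArg Fin.val e), .inr (.inr (.inl ⟨rfl, j, hj1, hj, rfl⟩))⟩

theorem cassette_edist_last_le_one (t i j : ℕ) (hj : (i - 1) / t + 2 ≤ j) (h : j * t + 2 ≤ n)
    (ht : 1 ≤ t) :
    (cassette n t i).edist ⟨j * t, by omega⟩ ⟨n - 1, by omega⟩ ≤ (1 : ℕ) := by
  refine (SimpleGraph.edist_eq_one_iff_adj.mpr ?_).le
  refine ⟨fun e => ?_, .inl (.inr (.inr ⟨rfl, j, hj, ?_, rfl⟩))⟩
  · have := congrArg Fin.val e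
    simp only at this
    omega
  · exact (Nat.le_div_iff_mul_le ht).mpr (by omega)

/-- Every vertex is close to the vertex `t` steps past the last one attached to `0`, or to `n - 1`
if there is no such vertex. -/
theorem cassette_edist_center_le (n t i v : ℕ) (ht : 1 ≤ t) (hi : i ≤ n) (hv : v < n) :
    (cassette n t i).edist ⟨v, hv⟩ ⟨min ((i - 1) / t * t + t) (n - 1), by omega⟩
      ≤ (2 * t + 1 : ℕ) := by
  have hk : (i - 1) / t * t ≤ i - 1 := Nat.div_mul_le_self _ _
  have hq : v / t * t ≤ v := Nat.div_mul_le_self _ _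
  have hr : v < v / t * t + t := by
    have := Nat.lt_div_mul_add (a := v) ht
    omega
  have hfloor : (cassette n t i).edist ⟨v, hv⟩ ⟨v / t * t, by omega⟩ ≤ (v - v / t * t : ℕ) := by
    rw [SimpleGraph.edist_comm]
    exact cassette_edist_le_sub t i _ _ _ _ hq
  rcases le_or_gt v ((i - 1) / t * t) with hvk | hvk
  · have hjk : v / t ≤ (i - 1) / t := Nat.div_le_div_right (by omega)
    have h0 := cassette_edist_zero_le_one t i (v / t) hjk (by omega : v / t * t < n)
    have h1 := cassette_edist_zero_le_one (n := n) t i ((i - 1) / t) le_rfl (by omega)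
    rw [SimpleGraph.edist_comm] at h1
    have h2 := cassette_edist_le_sub (n := n) t i ((i - 1) / t * t)
      (min ((i - 1) / t * t + t) (n - 1)) (by omega) (by omega) (by omega)
    exact edist_le_of_edist_le_of_edist_le
      (edist_le_of_edist_le_of_edist_le hfloor h0 le_rfl)
      (edist_le_of_edist_le_of_edist_le h1 h2 le_rfl) (by omega)
  rcases le_or_gt v (min ((i - 1) / t * t + t) (n - 1)) with hvc | hvc
  · refine (cassette_edist_le_sub t i _ _ hv _ hvc).trans (Nat.cast_le.mpr ?_)
    omega
  rcases le_or_gt v ((i - 1) / t * t + 2 * t) with hv2 | hv2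
  · rw [SimpleGraph.edist_comm]
    refine (cassette_edist_le_sub t i _ _ _ hv hvc.le).trans (Nat.cast_le.mpr ?_)
    omega
  have hm : ((i - 1) / t + 2) * t = (i - 1) / t * t + 2 * t := by ring
  have h1 := cassette_edist_last_le_one (n := n) t i ((i - 1) / t + 2) le_rfl (by omega) ht
  have h2 := cassette_edist_le_sub (n := n) t i (min ((i - 1) / t * t + t) (n - 1))
    (((i - 1) / t + 2) * t) (by omega) (by omega) (by omega)
  have h3 := edist_le_of_edist_le_of_edist_le h2 h1 le_rfl
  rw [SimpleGraph.edist_comm] at h3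
  rcases eq_or_ne v (n - 1) with rfl | hvn
  · refine h3.trans (Nat.cast_le.mpr ?_)
    omega
  · have hjq : (i - 1) / t + 2 ≤ v / t := (Nat.le_div_iff_mul_le ht).mpr (by omega)
    have h4 := cassette_edist_last_le_one (n := n) t i _ hjq (by omega) ht
    exact edist_le_of_edist_le_of_edist_le
      (edist_le_of_edist_le_of_edist_le hfloor h4 le_rfl) h3 (by omega)

/-- Every graph of the dynamic cassette graph is connected and has diameter at most
`5t + 4`. -/
theorem cassette_connected_diam (n t : ℕ) (ht : 1 ≤ t) (hn : 2 * t + 2 ≤ n) :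
    ∀ i : ℕ, 1 ≤ i → i ≤ n →
      (cassette n t i).Connected ∧ (cassette n t i).diam ≤ 5 * t + 4 := by
  intro i _ hi
  obtain ⟨hconn, hdiam⟩ := connected_and_diam_le_of_edist_le
    (⟨min ((i - 1) / t * t + t) (n - 1), by omega⟩ : Fin n) (2 * t + 1)
    fun v : Fin n => cassette_edist_center_le n t i v ht hi v.isLt
  exact ⟨hconn, by omega⟩

end SmoothedFlooding
end
end
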